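/- Define σ : C_n → C_n by letting σ(x) be the unique applicant whose rank rr_n(σ(x)) equals 1 + (rr_n(x) mod n), i.e., the cyclic successor in rank, and extend σ coordinatewise to sequences in Ω_n. Then σ : Ω_n → Ω_n is a bijection with σ^n = id, and for every r ∈ {3,…,n-1} and every x ∈ Π_n(r): the sequences σ^i(x) for i ∈ {1,…,n-1} are pairwise distinct and each σ^i(x) belongs to Λ_n(r) \ Π_n(r). -/

import Mathlib

open Finset

namespace Secretary

/-- Relative rank of `x` with regard to `P`: the number of `z ∈ P` with `z ≤ x`
(as an integer, so that differences can be computed in `ℤ`). -/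
def rr {n : ℕ} (P : Finset (Fin n)) (x : Fin n) : ℤ :=
  ((P.filter fun z => z ≤ x).card : ℤ)

/-- `Δ(k) = {-1, 1, k-1, 1-k} ⊆ ℤ`. -/
def Δ (k : ℕ) : Finset ℤ := {-1, 1, (k : ℤ) - 1, 1 - (k : ℤ)}

/-- `{x, y} ∈ Adj(P)`: both belong to `P` and the difference of their relative
ranks with regard to `P` (in one of the two orders) lies in `Δ(|P|)`. -/
def Adj {n : ℕ} (P : Finset (Fin n)) (x y : Fin n) : Prop :=
  x ∈ P ∧ y ∈ P ∧ (rr P x - rr P y ∈ Δ P.card ∨ rr P y - rr P x ∈ Δ P.card)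

instance {n : ℕ} (P : Finset (Fin n)) (x y : Fin n) : Decidable (Adj P x y) := by
  unfold Adj; infer_instance

/-- `Ω n`: the sequences of `n` distinct applicants (as injective, hence
bijective, functions `Fin n → Fin n`); `|Ω n| = n!`. -/
def Ω (n : ℕ) : Finset (Fin n → Fin n) :=
  Finset.univ.filter Function.Injective

/-- The `i`-th applicant of the sequence `x`, with the 1-based indexing
`x_1, …, x_n` of the paper. -/
def get {n : ℕ} [NeZero n] (x : Fin n → Fin n) (i : ℕ) : Fin n :=
  x ⟨(i - 1) % n, Nat.mod_lt _ (Nat.pos_of_ne_zero (NeZero.ne n))⟩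

/-- The set `{x_1, …, x_i}` of the first `i` applicants of the sequence `x`. -/
def pre {n : ℕ} (x : Fin n → Fin n) (i : ℕ) : Finset (Fin n) :=
  (Finset.univ.filter fun j : Fin n => (j : ℕ) < i).image x

/-- `Λ_n(r,k)`: sequences `x ∈ Ω_n` with `{x_k, x_{k+1}} ∈ Adj(C_n)` and
`{x_{i-1}, x_i} ∉ Adj({x_1,…,x_i})` for all `i ∈ {r,…,k}`. -/
def Lam : (n : ℕ) → ℕ → ℕ → Finset (Fin n → Fin n)
  | 0, _, _ => ∅
  | (m + 1), r, k =>
      (Ω (m + 1)).filter fun x =>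
        Adj Finset.univ (get x k) (get x (k + 1)) ∧
          ∀ i, i ≤ k → r ≤ i → ¬ Adj (pre x i) (get x (i - 1)) (get x i)

/-- `Λ_n(r) = ⋃_{k=r}^{n-1} Λ_n(r,k)`. -/
def LamU (n : ℕ) (r : ℕ) : Finset (Fin n → Fin n) :=
  (Finset.Icc r (n - 1)).biUnion fun k => Lam n r k

/-- `Π_n(r)`: those `x ∈ Λ_n(r)` such that for the (unique) `k` with
`x ∈ Λ_n(r,k)` one has `rr_n(x_k) - rr_n(x_{k+1}) ∈ {1-n, n-1}`. -/
def Pi' : (n : ℕ) → ℕ → Finset (Fin n → Fin n)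
  | 0, _ => ∅
  | (m + 1), r =>
      (LamU (m + 1) r).filter fun x =>
        ∃ k ∈ Finset.Icc r m, x ∈ Lam (m + 1) r k ∧
          rr Finset.univ (get x k) - rr Finset.univ (get x (k + 1)) ∈
            ({1 - ((m : ℤ) + 1), ((m : ℤ) + 1) - 1} : Finset ℤ)

/-- `Λ_n(r,k,z,z̄)`: sequences of `Λ_n(r,k)` with `x_k = z` and `x_{k+1} = z̄`. -/
def Lam4 : (n : ℕ) → ℕ → ℕ → Fin n → Fin n → Finset (Fin n → Fin n)
  | 0, _, _, z, _ => z.elim0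
  | (m + 1), r, k, z, w =>
      (Lam (m + 1) r k).filter fun x => get x k = z ∧ get x (k + 1) = w

lemma rr_univ {n : ℕ} (x : Fin n) : rr Finset.univ x = (x : ℤ) + 1 := by
  have h : (Finset.univ.filter fun z => z ≤ x) = Finset.Iic x := by ext; simp
  simp [rr, h, Fin.card_Iic]

lemma one_le_rr {n : ℕ} {P : Finset (Fin n)} {x : Fin n} (hx : x ∈ P) : 1 ≤ rr P x := by
  have : 0 < (P.filter fun z => z ≤ x).card := Finset.card_pos.2 ⟨x, by simp [hx]⟩
  unfold rr
  omega

lemma rr_lt_rr {n : ℕ} {P : Finset (Fin n)} {x y : Fin n} (hx : x ∈ P) (h : y < x) :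
    rr P y < rr P x := by
  unfold rr
  refine Nat.cast_lt.2 (Finset.card_lt_card ((Finset.ssubset_iff_of_subset fun z hz => ?_).2
    ⟨x, by simp [hx], by simp [h]⟩))
  rw [Finset.mem_filter] at hz ⊢
  exact ⟨hz.1, hz.2.trans h.le⟩

lemma rr_succ {n : ℕ} {P : Finset (Fin n)} {x y : Fin n} (hx : x ∈ P)
    (h : (x : ℕ) = y + 1) : rr P x = rr P y + 1 := by
  have : (P.filter fun z => z ≤ x) = insert x (P.filter fun z => z ≤ y) := by
    ext z
    simp only [Finset.mem_filter, Finset.mem_insert, Fin.le_def, Fin.ext_iff]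
    constructor
    · rintro ⟨hz, hzx⟩
      by_cases hzy : (z : ℕ) ≤ y
      · exact Or.inr ⟨hz, hzy⟩
      · exact Or.inl (by omega)
    · rintro (hz | hz)
      · exact ⟨Fin.ext hz ▸ hx, by omega⟩
      · exact ⟨hz.1, by omega⟩
  unfold rr
  rw [this, Finset.card_insert_of_notMem, Nat.cast_add, Nat.cast_one]
  simp only [Finset.mem_filter, Fin.le_def, not_and]
  omega

lemma rr_of_val_eq_zero {n : ℕ} {P : Finset (Fin n)} {x : Fin n} (hx : x ∈ P)
    (h : (x : ℕ) = 0) : rr P x = 1 := by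
  have : (P.filter fun z => z ≤ x) = {x} := by
    ext z
    simp only [Finset.mem_filter, Finset.mem_singleton, Fin.le_def, Fin.ext_iff]
    constructor
    · rintro ⟨-, hz⟩
      omega
    · intro hz
      exact ⟨Fin.ext hz ▸ hx, by omega⟩
  simp [rr, this]

lemma rr_of_val_add_one_eq {n : ℕ} (P : Finset (Fin n)) {x : Fin n}
    (h : (x : ℕ) + 1 = n) : rr P x = P.card := by
  unfold rr
  rw [Finset.filter_true_of_mem]
  intro z _
  rw [Fin.le_def]
  omega

lemma mem_Δ {k : ℕ} {d : ℤ} :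
    d ∈ Δ k ↔ d = -1 ∨ d = 1 ∨ d = (k : ℤ) - 1 ∨ d = 1 - (k : ℤ) := by
  simp [Δ]

lemma Adj.symm {n : ℕ} {P : Finset (Fin n)} {x y : Fin n} (h : Adj P x y) : Adj P y x :=
  ⟨h.2.1, h.1, h.2.2.symm⟩

lemma Adj.of_univ {n : ℕ} {P : Finset (Fin n)} {x y : Fin n} (h : Adj Finset.univ x y)
    (hx : x ∈ P) (hy : y ∈ P) : Adj P x y := by
  have key : ∀ {x y : Fin n}, x ∈ P → y ∈ P →
      ((x : ℕ) = y + 1 ∨ ((x : ℕ) + 1 = n ∧ (y : ℕ) = 0)) → Adj P x y := by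
    rintro x y hx hy (h | ⟨h, h'⟩)
    · refine ⟨hx, hy, Or.inl (mem_Δ.2 ?_)⟩
      rw [rr_succ hx h]
      omega
    · refine ⟨hx, hy, Or.inl (mem_Δ.2 ?_)⟩
      rw [rr_of_val_add_one_eq P h, rr_of_val_eq_zero hy h']
      omega
  obtain ⟨-, -, h⟩ := h
  simp only [mem_Δ, rr_univ, Finset.card_univ, Fintype.card_fin] at h
  have hx' := x.isLt
  have hy' := y.isLt
  by_cases h1 : (x : ℕ) = y + 1 ∨ ((x : ℕ) + 1 = n ∧ (y : ℕ) = 0)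
  · exact key hx hy h1
  · exact (key hy hx (by omega)).symm

section Shift

variable {n : ℕ} {σ : Fin n → Fin n}

lemma injective_of_val_eq (hσ : ∀ x, (σ x : ℕ) = (x + 1) % n) : Function.Injective σ := by
  intro x y h
  have hxy : ((x : ℕ) + 1) % n = (y + 1) % n := by rw [← hσ, ← hσ, h]
  have hm : (x : ℕ) ≡ y [MOD n] := Nat.ModEq.add_right_cancel' 1 hxy
  exact Fin.ext (Nat.ModEq.eq_of_lt_of_lt hm x.isLt y.isLt)

lemma iterate_val (hσ : ∀ x, (σ x : ℕ) = (x + 1) % n) (i : ℕ) (x : Fin n) :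
    (σ^[i] x : ℕ) = (x + i) % n := by
  induction i with
  | zero => simp [Nat.mod_eq_of_lt x.isLt]
  | succ i ih => rw [Function.iterate_succ_apply', hσ, ih, Nat.mod_add_mod, add_assoc]

lemma val_of_ne_last (hσ : ∀ x, (σ x : ℕ) = (x + 1) % n) {x : Fin n} (h : (x : ℕ) + 1 ≠ n) :
    (σ x : ℕ) = x + 1 := by
  have := x.isLt
  rw [hσ, Nat.mod_eq_of_lt (by omega)]

lemma val_of_last (hσ : ∀ x, (σ x : ℕ) = (x + 1) % n) {x : Fin n} (h : (x : ℕ) + 1 = n) :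
    (σ x : ℕ) = 0 := by
  rw [hσ, h, Nat.mod_self]

lemma rr_image_of_last_notMem (hσ : ∀ x, (σ x : ℕ) = (x + 1) % n) {P : Finset (Fin n)}
    (hP : ∀ z ∈ P, (z : ℕ) + 1 ≠ n) {x : Fin n} (hx : (x : ℕ) + 1 ≠ n) :
    rr (P.image σ) (σ x) = rr P x := by
  unfold rr
  rw [Finset.filter_image, Finset.card_image_of_injective _ (injective_of_val_eq hσ)]
  congr 2
  refine Finset.filter_congr fun z hz => ?_
  rw [Fin.le_def, Fin.le_def, val_of_ne_last hσ hx, val_of_ne_last hσ (hP z hz)]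
  omega

lemma rr_image_of_last_mem (hσ : ∀ x, (σ x : ℕ) = (x + 1) % n) {P : Finset (Fin n)} {l : Fin n}
    (hl : l ∈ P) (hln : (l : ℕ) + 1 = n) {x : Fin n} (hx : (x : ℕ) + 1 ≠ n) :
    rr (P.image σ) (σ x) = rr P x + 1 := by
  unfold rr
  rw [Finset.filter_image, Finset.card_image_of_injective _ (injective_of_val_eq hσ)]
  have : (P.filter fun z => σ z ≤ σ x) = insert l (P.filter fun z => z ≤ x) := by
    ext z
    simp only [Finset.mem_filter, Finset.mem_insert]
    have hz := z.isLt
    by_cases h : (z : ℕ) + 1 = n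
    · have hzl : z = l := Fin.ext (by omega)
      subst hzl
      exact iff_of_true ⟨hl, by rw [Fin.le_def, val_of_last hσ h]; exact Nat.zero_le _⟩ (Or.inl rfl)
    · have hzl : z ≠ l := fun e => h (e ▸ hln)
      rw [Fin.le_def, Fin.le_def, val_of_ne_last hσ hx, val_of_ne_last hσ h]
      simp [hzl]
  have hxl := x.isLt
  rw [this, Finset.card_insert_of_notMem, Nat.cast_add, Nat.cast_one]
  simp only [Finset.mem_filter, Fin.le_def, not_and]
  omega

lemma adj_image_iff (hσ : ∀ x, (σ x : ℕ) = (x + 1) % n) (P : Finset (Fin n)) (x y : Fin n) :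
    Adj (P.image σ) (σ x) (σ y) ↔ Adj P x y := by
  have hinj := injective_of_val_eq hσ
  unfold Adj
  rw [Finset.card_image_of_injective _ hinj, hinj.mem_finset_image, hinj.mem_finset_image]
  refine and_congr_right fun hx => and_congr_right fun hy => ?_
  have key : ∀ {x y : Fin n}, x ∈ P → y ∈ P → (x : ℕ) + 1 = n → (y : ℕ) + 1 ≠ n →
      rr (P.image σ) (σ x) = 1 ∧ rr P x = P.card ∧ rr (P.image σ) (σ y) = rr P y + 1 ∧
        1 ≤ rr P y ∧ rr P y < P.card := by
    intro x y hx hy hxl hyl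
    have hyn := y.isLt
    have hlt : rr P y < rr P x := rr_lt_rr hx (Fin.lt_def.2 (by omega))
    have hxc := rr_of_val_add_one_eq P hxl
    exact ⟨rr_of_val_eq_zero (Finset.mem_image_of_mem σ hx) (val_of_last hσ hxl), hxc,
      rr_image_of_last_mem hσ hx hxl hyl, one_le_rr hy, hxc ▸ hlt⟩
  simp only [mem_Δ]
  by_cases hxl : (x : ℕ) + 1 = n <;> by_cases hyl : (y : ℕ) + 1 = n
  · have : x = y := Fin.ext (by omega)
    subst this
    simp
  · obtain ⟨h1, h2, h3, h4, h5⟩ := key hx hy hxl hyl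
    omega
  · obtain ⟨h1, h2, h3, h4, h5⟩ := key hy hx hyl hxl
    omega
  · by_cases hP : ∀ z ∈ P, (z : ℕ) + 1 ≠ n
    · rw [rr_image_of_last_notMem hσ hP hxl, rr_image_of_last_notMem hσ hP hyl]
    · push Not at hP
      obtain ⟨l, hl, hln⟩ := hP
      rw [rr_image_of_last_mem hσ hl hln hxl, rr_image_of_last_mem hσ hl hln hyl,
        add_sub_add_right_eq_sub, add_sub_add_right_eq_sub]

end Shift

lemma mem_Lam {n : ℕ} [NeZero n] {r k : ℕ} {x : Fin n → Fin n} :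
    x ∈ Lam n r k ↔ Function.Injective x ∧ Adj Finset.univ (get x k) (get x (k + 1)) ∧
      ∀ i, i ≤ k → r ≤ i → ¬ Adj (pre x i) (get x (i - 1)) (get x i) := by
  cases n with
  | zero => exact absurd rfl (NeZero.ne 0)
  | succ m => simp only [Lam, Ω, Finset.mem_filter, Finset.mem_univ, true_and]

lemma mem_LamU {n r : ℕ} {x : Fin n → Fin n} :
    x ∈ LamU n r ↔ ∃ k ∈ Finset.Icc r (n - 1), x ∈ Lam n r k := by
  simp [LamU]

lemma mem_Pi' {n : ℕ} [NeZero n] {r : ℕ} {x : Fin n → Fin n} :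
    x ∈ Pi' n r ↔ ∃ k ∈ Finset.Icc r (n - 1), x ∈ Lam n r k ∧
      ((get x k : ℤ) - get x (k + 1) = 1 - n ∨ (get x k : ℤ) - get x (k + 1) = n - 1) := by
  cases n with
  | zero => exact absurd rfl (NeZero.ne 0)
  | succ m =>
    simp only [Pi', Finset.mem_filter, mem_LamU, rr_univ, Finset.mem_insert,
      Finset.mem_singleton, add_sub_add_right_eq_sub, Nat.add_sub_cancel, Nat.cast_add,
      Nat.cast_one]
    constructor
    · exact fun h => h.2
    · rintro ⟨k, hk, hx, h⟩
      exact ⟨⟨k, hk, hx⟩, k, hk, hx, h⟩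

lemma get_mem_pre {n : ℕ} [NeZero n] (x : Fin n → Fin n) {i j : ℕ} (hi : 1 ≤ i) (hij : i ≤ j) :
    get x i ∈ pre x j := by
  refine Finset.mem_image_of_mem x ?_
  have := Nat.mod_le (i - 1) n
  simp only [Finset.mem_filter, Finset.mem_univ, true_and]
  omega

lemma Lam_index_unique {n : ℕ} [NeZero n] {r k k' : ℕ} (hr : 1 ≤ r) (hk : r ≤ k) (hk' : r ≤ k')
    {x : Fin n → Fin n} (h : x ∈ Lam n r k) (h' : x ∈ Lam n r k') : k = k' := by
  have key : ∀ {k k' : ℕ}, r ≤ k → x ∈ Lam n r k → x ∈ Lam n r k' → ¬ k < k' := by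
    intro k k' hk h h' hlt
    exact (mem_Lam.1 h').2.2 (k + 1) hlt (by omega)
      ((mem_Lam.1 h).2.1.of_univ (get_mem_pre x (by omega) (by omega))
        (get_mem_pre x (by omega) le_rfl))
  have := key hk h h'
  have := key hk' h' h
  omega

lemma comp_mem_Lam {n : ℕ} [NeZero n] {σ : Fin n → Fin n}
    (hσ : ∀ x, (σ x : ℕ) = (x + 1) % n) {r k : ℕ} {x : Fin n → Fin n} (h : x ∈ Lam n r k) :
    σ ∘ x ∈ Lam n r k := by
  have hinj := injective_of_val_eq hσ
  obtain ⟨h1, h2, h3⟩ := mem_Lam.1 h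
  refine mem_Lam.2 ⟨hinj.comp h1, ?_, fun i hi hr hadj => h3 i hi hr ?_⟩
  · rw [← Finset.image_univ_of_surjective (Finite.surjective_of_injective hinj)]
    exact (adj_image_iff hσ _ _ _).2 h2
  · rw [pre, ← Finset.image_image] at hadj
    exact (adj_image_iff hσ _ _ _).1 hadj

lemma iterate_comp_mem_Lam {n : ℕ} [NeZero n] {σ : Fin n → Fin n}
    (hσ : ∀ x, (σ x : ℕ) = (x + 1) % n) {r k : ℕ} {x : Fin n → Fin n} (h : x ∈ Lam n r k)
    (i : ℕ) : σ^[i] ∘ x ∈ Lam n r k := by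
  induction i with
  | zero => exact h
  | succ i ih =>
    rw [Function.iterate_succ', Function.comp_assoc]
    exact comp_mem_Lam hσ ih

/-- let `σ : C_n → C_n` be the cyclic successor in rank, i.e.
`rr_n(σ x) = 1 + (rr_n x mod n)`, extended coordinatewise to sequences. Then
`σ` is a bijection with `σ^n = id` (hence a bijection of `Ω_n`), and for every
`r ∈ {3,…,n-1}` and `x ∈ Π_n(r)`, the sequences `σ^i(x)`, `i ∈ {1,…,n-1}`, are
pairwise distinct and all belong to `Λ_n(r) \ Π_n(r)`. -/
theorem statement11 {n : ℕ} [NeZero n] (hn : 3 < n) (σ : Fin n → Fin n)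
    (hσ : ∀ x : Fin n, rr Finset.univ (σ x) = 1 + rr Finset.univ x % (n : ℤ)) :
    Function.Bijective σ ∧
    σ^[n] = id ∧
    Set.BijOn (fun x : Fin n → Fin n => σ ∘ x) (Ω n : Set (Fin n → Fin n)) (Ω n : Set (Fin n → Fin n)) ∧
    ∀ r, 3 ≤ r → r ≤ n - 1 → ∀ x ∈ Pi' n r,
      Set.InjOn (fun i => σ^[i] ∘ x) (Set.Icc 1 (n - 1)) ∧
      ∀ i ∈ Set.Icc 1 (n - 1), σ^[i] ∘ x ∈ LamU n r \ Pi' n r := by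
  have hv : ∀ x, (σ x : ℕ) = (x + 1) % n := fun x => by
    have h := hσ x
    rw [rr_univ, rr_univ] at h
    zify
    linarith
  have hinj := injective_of_val_eq hv
  have hlast : ∀ {i : ℕ}, i ∈ Set.Icc 1 (n - 1) → ∀ {a b : Fin n}, (a : ℕ) = 0 →
      (b : ℕ) + 1 = n → (σ^[i] a : ℕ) = σ^[i] b + 1 := by
    intro i hi a b ha hb
    obtain ⟨hi1, hi2⟩ := hi
    rw [iterate_val hv, iterate_val hv, ha, zero_add, Nat.mod_eq_of_lt (by omega),
      show (b : ℕ) + i = (i - 1) + n by omega, Nat.add_mod_right, Nat.mod_eq_of_lt (by omega)]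
    omega
  refine ⟨Finite.injective_iff_bijective.1 hinj, ?_, ?_, fun r hr _ x hx => ⟨?_, ?_⟩⟩
  · funext x
    exact Fin.ext (by rw [iterate_val hv, Nat.add_mod_right, Nat.mod_eq_of_lt x.isLt, id])
  · have hmaps : Set.MapsTo (fun x : Fin n → Fin n => σ ∘ x) (Ω n : Set (Fin n → Fin n))
        (Ω n : Set (Fin n → Fin n)) := by
      intro x hx
      simp only [Ω, Finset.coe_filter, Finset.mem_univ, true_and, Set.mem_ofPred_eq] at hx ⊢
      exact hinj.comp hx
    have hinjOn : Set.InjOn (fun x : Fin n → Fin n => σ ∘ x) (Ω n : Set (Fin n → Fin n)) :=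
      hinj.comp_left.injOn
    exact ⟨hmaps, hinjOn, Finset.surjOn_of_injOn_of_card_le _ hmaps hinjOn le_rfl⟩
  · rintro i ⟨-, hi⟩ j ⟨-, hj⟩ hij
    have h : σ^[i] (x 0) = σ^[j] (x 0) := congrFun hij 0
    have hm : ((x 0 : ℕ) + i) % n = (x 0 + j) % n := by rw [← iterate_val hv, ← iterate_val hv, h]
    exact Nat.ModEq.eq_of_lt_of_lt (Nat.ModEq.add_left_cancel' _ hm) (by omega) (by omega)
  · intro i hi
    obtain ⟨k, hk, hxk, hd⟩ := mem_Pi'.1 hx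
    have hmem := iterate_comp_mem_Lam hv hxk i
    refine Finset.mem_sdiff.2 ⟨mem_LamU.2 ⟨k, hk, hmem⟩, fun hPi => ?_⟩
    obtain ⟨k', hk', hxk', hd'⟩ := mem_Pi'.1 hPi
    obtain rfl := Lam_index_unique (by omega) (Finset.mem_Icc.1 hk).1 (Finset.mem_Icc.1 hk').1
      hmem hxk'
    change ((σ^[i] (get x k) : Fin n) : ℤ) - (σ^[i] (get x (k + 1)) : Fin n) = _ ∨
      ((σ^[i] (get x k) : Fin n) : ℤ) - (σ^[i] (get x (k + 1)) : Fin n) = _ at hd'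
    have hx1 := (get x k).isLt
    have hx2 := (get x (k + 1)).isLt
    rcases hd with hd | hd
    · have := hlast hi (a := get x k) (b := get x (k + 1)) (by omega) (by omega)
      omega
    · have := hlast hi (a := get x (k + 1)) (b := get x k) (by omega) (by omega)
      omega
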